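/- Let c be a real number. With J₁ = x₂p₃ − x₃p₂, J₂ = x₃p₁ − x₁p₃, J₃ = x₁p₂ − x₂p₁, define the Goryachev–Chaplygin integrals H = J₁² + J₂² + 4J₃² − 2c x₂ and K = J₃(J₁² + J₂²) + c x₃ J₂. Then {H, K}_S = 0 at every point of the constraint surface T*S² (where x₁²+x₂²+x₃² = 1 and x₁p₁+x₂p₂+x₃p₃ = 0). -/

import Mathlib

noncomputable section

/-- Phase space T*ℝ³ = ℝ³ × ℝ³ with coordinates (x, p). -/
abbrev Phase : Type := (Fin 3 → ℝ) × (Fin 3 → ℝ)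

/-- Canonical Poisson bracket on ℝ³ × ℝ³:
{f,g} = Σᵢ (∂f/∂xᵢ ∂g/∂pᵢ − ∂f/∂pᵢ ∂g/∂xᵢ). -/
noncomputable def pb (f g : Phase → ℝ) (z : Phase) : ℝ :=
  ∑ i : Fin 3,
    (fderiv ℝ f z (Pi.single i 1, 0) * fderiv ℝ g z (0, Pi.single i 1) -
     fderiv ℝ f z (0, Pi.single i 1) * fderiv ℝ g z (Pi.single i 1, 0))

/-- Dirac bracket associated with constraints F₁, F₂:
{f,g}_D = {f,g} − ({F₁,f}{F₂,g} − {F₁,g}{F₂,f})/{F₁,F₂}. -/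
noncomputable def dirac (F₁ F₂ f g : Phase → ℝ) (z : Phase) : ℝ :=
  pb f g z - (pb F₁ f z * pb F₂ g z - pb F₁ g z * pb F₂ f z) / pb F₁ F₂ z
/-- Sphere constraint F₁ = x₁² + x₂² + x₃² − 1. -/
def sphereF₁ : Phase → ℝ := fun z => z.1 0 ^ 2 + z.1 1 ^ 2 + z.1 2 ^ 2 - 1

/-- Sphere constraint F₂ = x₁p₁ + x₂p₂ + x₃p₃. -/
def sphereF₂ : Phase → ℝ := fun z => z.1 0 * z.2 0 + z.1 1 * z.2 1 + z.1 2 * z.2 2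

/-- Sphere Dirac bracket {·,·}_S. -/
noncomputable def diracS (f g : Phase → ℝ) (z : Phase) : ℝ :=
  dirac sphereF₁ sphereF₂ f g z

/-- Angular momentum J₁ = x₂p₃ − x₃p₂. -/
noncomputable def J1 : Phase → ℝ := fun z => z.1 1 * z.2 2 - z.1 2 * z.2 1
/-- Angular momentum J₂ = x₃p₁ − x₁p₃. -/
noncomputable def J2 : Phase → ℝ := fun z => z.1 2 * z.2 0 - z.1 0 * z.2 2
/-- Angular momentum J₃ = x₁p₂ − x₂p₁. -/
noncomputable def J3 : Phase → ℝ := fun z => z.1 0 * z.2 1 - z.1 1 * z.2 0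

/-- The canonical bracket in terms of explicit derivatives of the two functions. -/
lemma pb_eq_of_hasFDerivAt {f g : Phase → ℝ} {f' g' : Phase →L[ℝ] ℝ} {z : Phase}
    (hf : HasFDerivAt f f' z) (hg : HasFDerivAt g g' z) :
    pb f g z = ∑ i : Fin 3,
      (f' (Pi.single i 1, 0) * g' (0, Pi.single i 1) -
        f' (0, Pi.single i 1) * g' (Pi.single i 1, 0)) := by
  rw [pb, hf.fderiv, hg.fderiv]

/-- The differential of the position coordinate `xᵢ`. -/
lemma hasFDerivAt_position (i : Fin 3) (z : Phase) :
    HasFDerivAt (fun w : Phase => w.1 i)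
      ((ContinuousLinearMap.proj (R := ℝ) (φ := fun _ : Fin 3 => ℝ) i).comp
        (ContinuousLinearMap.fst ℝ (Fin 3 → ℝ) (Fin 3 → ℝ))) z :=
  ((ContinuousLinearMap.proj (R := ℝ) (φ := fun _ : Fin 3 => ℝ) i).comp
    (ContinuousLinearMap.fst ℝ (Fin 3 → ℝ) (Fin 3 → ℝ))).hasFDerivAt

/-- The differential of the momentum coordinate `pᵢ`. -/
lemma hasFDerivAt_momentum (i : Fin 3) (z : Phase) :
    HasFDerivAt (fun w : Phase => w.2 i)
      ((ContinuousLinearMap.proj (R := ℝ) (φ := fun _ : Fin 3 => ℝ) i).comp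
        (ContinuousLinearMap.snd ℝ (Fin 3 → ℝ) (Fin 3 → ℝ))) z :=
  ((ContinuousLinearMap.proj (R := ℝ) (φ := fun _ : Fin 3 => ℝ) i).comp
    (ContinuousLinearMap.snd ℝ (Fin 3 → ℝ) (Fin 3 → ℝ))).hasFDerivAt

/-- the Goryachev–Chaplygin integrals H = J₁² + J₂² + 4J₃² − 2cx₂
and K = J₃(J₁² + J₂²) + cx₃J₂ are in involution with respect to the sphere
Dirac bracket on T*S². -/
theorem goryachev_chaplygin_sphere_involution
    (c : ℝ) (z : Phase)
    (h1 : z.1 0 ^ 2 + z.1 1 ^ 2 + z.1 2 ^ 2 = 1)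
    (h2 : z.1 0 * z.2 0 + z.1 1 * z.2 1 + z.1 2 * z.2 2 = 0) :
    diracS
      (fun w => J1 w ^ 2 + J2 w ^ 2 + 4 * J3 w ^ 2 - 2 * c * w.1 1)
      (fun w => J3 w * (J1 w ^ 2 + J2 w ^ 2) + c * w.1 2 * J2 w) z = 0 := by
  have hx := fun i => hasFDerivAt_position i z
  have hp := fun i => hasFDerivAt_momentum i z
  have hJ1 : HasFDerivAt J1 _ z := ((hx 1).mul (hp 2)).sub ((hx 2).mul (hp 1))
  have hJ2 : HasFDerivAt J2 _ z := ((hx 2).mul (hp 0)).sub ((hx 0).mul (hp 2))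
  have hJ3 : HasFDerivAt J3 _ z := ((hx 0).mul (hp 1)).sub ((hx 1).mul (hp 0))
  have hF₁ : HasFDerivAt sphereF₁ _ z :=
    ((((hx 0).pow 2).add ((hx 1).pow 2)).add ((hx 2).pow 2)).sub_const 1
  have hH : HasFDerivAt (fun w => J1 w ^ 2 + J2 w ^ 2 + 4 * J3 w ^ 2 - 2 * c * w.1 1) _ z :=
    (((hJ1.pow 2).add (hJ2.pow 2)).add ((hJ3.pow 2).const_mul 4)).sub ((hx 1).const_mul (2 * c))
  have hK : HasFDerivAt (fun w => J3 w * (J1 w ^ 2 + J2 w ^ 2) + c * w.1 2 * J2 w) _ z :=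
    (hJ3.mul ((hJ1.pow 2).add (hJ2.pow 2))).add (((hx 2).const_mul c).mul hJ2)
  have hF₁H : pb sphereF₁ (fun w => J1 w ^ 2 + J2 w ^ 2 + 4 * J3 w ^ 2 - 2 * c * w.1 1) z = 0 := by
    rw [pb_eq_of_hasFDerivAt hF₁ hH]
    simp [Fin.sum_univ_three, J1, J2, J3]
    ring
  have hF₁K : pb sphereF₁ (fun w => J3 w * (J1 w ^ 2 + J2 w ^ 2) + c * w.1 2 * J2 w) z = 0 := by
    rw [pb_eq_of_hasFDerivAt hF₁ hK]
    simp [Fin.sum_univ_three, J1, J2, J3]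
    ring
  rw [diracS, dirac, hF₁H, hF₁K, pb_eq_of_hasFDerivAt hH hK]
  simp [Fin.sum_univ_three, J1, J2, J3]
  ring
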